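/- arXiv:1212.2354 — 4 statements merged into one kernel-verified Lean document; each statement's English description precedes it below -/
import Mathlib

section
/- Suppose the block matrix T = [[K, L],[K_D, L_D]] is symplectic, i.e. T^⊤ · diag(Δ_A, Δ_D) · T = diag(Δ_B, Δ_E), and assume additionally that Δ_X Δ_X = −I for each X ∈ {A, B, D, E}. Then the image under K of the kernel of K_D equals the kernel of L^⊤ Δ_A (which is the skew-orthogonal complement of the range of L with respect to the form Δ_A), i.e. K(ker K_D) = ker(L^⊤ Δ_A); moreover, the kernel of K_D equals the image of the kernel of L^⊤ Δ_A under the matrix Δ_B K^⊤ Δ_A, i.e. ker K_D = (Δ_B K^⊤ Δ_A)(ker(L^⊤ Δ_A)). -/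
open Matrix

/-- (Lemma 2, first assertion): if the block matrix `T = [[K, L],[K_D, L_D]]` is symplectic,
i.e. `Tᵀ · diag(Δ_A, Δ_D) · T = diag(Δ_B, Δ_E)`, and `Δ_X Δ_X = -I` for each `X ∈ {A,B,D,E}`,
then `K(ker K_D) = ker(Lᵀ Δ_A)` (the latter being the skew-orthogonal complement of `Ran L`
with respect to `Δ_A`) and `ker K_D = (Δ_B Kᵀ Δ_A)(ker(Lᵀ Δ_A))`. -/
theorem symplectic_block_matrix_kernel_images
    (nA nB nD nE : ℕ) (hdim : nA + nD = nB + nE)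
    (ΔA : Matrix (Fin nA) (Fin nA) ℝ) (ΔB : Matrix (Fin nB) (Fin nB) ℝ)
    (ΔD : Matrix (Fin nD) (Fin nD) ℝ) (ΔE : Matrix (Fin nE) (Fin nE) ℝ)
    (hAinv : IsUnit ΔA) (hBinv : IsUnit ΔB) (hDinv : IsUnit ΔD) (hEinv : IsUnit ΔE)
    (hAalt : ΔAᵀ = -ΔA) (hBalt : ΔBᵀ = -ΔB) (hDalt : ΔDᵀ = -ΔD) (hEalt : ΔEᵀ = -ΔE)
    (hAsq : ΔA * ΔA = -1) (hBsq : ΔB * ΔB = -1) (hDsq : ΔD * ΔD = -1) (hEsq : ΔE * ΔE = -1)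
    (K : Matrix (Fin nA) (Fin nB) ℝ) (L : Matrix (Fin nA) (Fin nE) ℝ)
    (KD : Matrix (Fin nD) (Fin nB) ℝ) (LD : Matrix (Fin nD) (Fin nE) ℝ)
    (hT : (Matrix.fromBlocks K L KD LD)ᵀ * Matrix.fromBlocks ΔA 0 0 ΔD *
        Matrix.fromBlocks K L KD LD = Matrix.fromBlocks ΔB 0 0 ΔE) :
    Submodule.map K.mulVecLin (LinearMap.ker KD.mulVecLin) =
        LinearMap.ker (Lᵀ * ΔA).mulVecLin ∧
    LinearMap.ker KD.mulVecLin =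
        Submodule.map (ΔB * Kᵀ * ΔA).mulVecLin (LinearMap.ker (Lᵀ * ΔA).mulVecLin) := by
  have hST : (Matrix.fromBlocks (-ΔB) 0 0 (-ΔE) * ((Matrix.fromBlocks K L KD LD)ᵀ *
      Matrix.fromBlocks ΔA 0 0 ΔD)) * Matrix.fromBlocks K L KD LD = 1 := by
    rw [Matrix.mul_assoc, hT, Matrix.fromBlocks_multiply, ← Matrix.fromBlocks_one]
    simp [hBsq, hEsq]
  have hcard : Fintype.card (Fin nB ⊕ Fin nE) = Fintype.card (Fin nA ⊕ Fin nD) := by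
    simp [hdim]
  have hTS := (Matrix.mul_eq_one_comm_of_equiv (Fintype.equivOfCardEq hcard)).1 hST
  rw [Matrix.fromBlocks_transpose, Matrix.fromBlocks_multiply, Matrix.fromBlocks_multiply,
    Matrix.fromBlocks_multiply, ← Matrix.fromBlocks_one, Matrix.fromBlocks_inj] at hTS
  rw [Matrix.fromBlocks_transpose, Matrix.fromBlocks_multiply, Matrix.fromBlocks_multiply,
    Matrix.fromBlocks_inj] at hT
  obtain ⟨h1, -, h2, -⟩ := hTS
  obtain ⟨g1, -, g2, -⟩ := hT
  simp only [Matrix.mul_zero, Matrix.zero_mul, add_zero, zero_add, Matrix.neg_mul,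
    Matrix.mul_neg] at h1 h2 g1 g2
  have a1 : ∀ z, (Lᵀ * ΔA) *ᵥ z = 0 → K *ᵥ ((ΔB * Kᵀ * ΔA) *ᵥ z) = -z := by
    intro z hz
    have := congrArg (fun M => M *ᵥ z) h1
    simp only [Matrix.add_mulVec, Matrix.neg_mulVec, Matrix.one_mulVec,
      ← Matrix.mulVec_mulVec] at this hz ⊢
    rw [hz] at this
    simp only [Matrix.mulVec_zero, neg_zero, add_zero] at this
    exact neg_eq_iff_eq_neg.1 this
  have a2 : ∀ z, (Lᵀ * ΔA) *ᵥ z = 0 → KD *ᵥ ((ΔB * Kᵀ * ΔA) *ᵥ z) = 0 := by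
    intro z hz
    have := congrArg (fun M => M *ᵥ z) h2
    simp only [Matrix.add_mulVec, Matrix.neg_mulVec, Matrix.zero_mulVec,
      ← Matrix.mulVec_mulVec] at this hz ⊢
    rw [hz] at this
    simpa only [Matrix.mulVec_zero, neg_zero, add_zero, neg_eq_zero] using this
  have b1 : ∀ v, KD *ᵥ v = 0 → (ΔB * Kᵀ * ΔA) *ᵥ (K *ᵥ v) = -v := by
    intro v hv
    have := congrArg (fun M => ΔB *ᵥ (M *ᵥ v)) g1
    have hB : ΔB *ᵥ (ΔB *ᵥ v) = -v := by
      rw [Matrix.mulVec_mulVec, hBsq, Matrix.neg_mulVec, Matrix.one_mulVec]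
    simp only [Matrix.add_mulVec, ← Matrix.mulVec_mulVec, hv, hB, Matrix.mulVec_zero,
      add_zero] at this ⊢
    exact this
  have b2 : ∀ v, KD *ᵥ v = 0 → (Lᵀ * ΔA) *ᵥ (K *ᵥ v) = 0 := by
    intro v hv
    have := congrArg (fun M => M *ᵥ v) g2
    simp only [Matrix.add_mulVec, ← Matrix.mulVec_mulVec, hv, Matrix.mulVec_zero,
      add_zero, Matrix.zero_mulVec] at this ⊢
    exact this
  constructor
  · ext z
    simp only [Submodule.mem_map, LinearMap.mem_ker, Matrix.mulVecLin_apply]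
    constructor
    · rintro ⟨v, hv, rfl⟩
      exact b2 v hv
    · intro hz
      refine ⟨-((ΔB * Kᵀ * ΔA) *ᵥ z), ?_, ?_⟩
      · rw [Matrix.mulVec_neg, a2 z hz, neg_zero]
      · rw [Matrix.mulVec_neg, a1 z hz, neg_neg]
  · ext v
    simp only [Submodule.mem_map, LinearMap.mem_ker, Matrix.mulVecLin_apply]
    constructor
    · intro hv
      refine ⟨-(K *ᵥ v), ?_, ?_⟩
      · rw [Matrix.mulVec_neg, b2 v hv, neg_zero]
      · rw [Matrix.mulVec_neg, b1 v hv, neg_neg]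
    · rintro ⟨z, hz, rfl⟩
      exact a2 z hz
end

section
/- Suppose the block matrix T = [[K, L],[K_D, L_D]] is symplectic, i.e. T^⊤ · diag(Δ_A, Δ_D) · T = diag(Δ_B, Δ_E), and assume additionally that Δ_X Δ_X = −I for each X ∈ {A, B, D, E}. Let M = Δ_B K^⊤ Δ_A. Then the restriction of M to the kernel of L^⊤ Δ_A is injective (i.e. ker M ∩ ker(L^⊤ Δ_A) = {0}) and symplectic, i.e. (M z₁)^⊤ Δ_B (M z₂) = z₁^⊤ Δ_A z₂ for all z₁, z₂ ∈ ker(L^⊤ Δ_A). -/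
open Matrix

/-- (Lemma 2, second assertion, second part): if the block matrix `T = [[K, L],[K_D, L_D]]` is
symplectic, i.e. `Tᵀ · diag(Δ_A, Δ_D) · T = diag(Δ_B, Δ_E)`, and `Δ_X Δ_X = -I` for each
`X ∈ {A,B,D,E}`, then, with `M = Δ_B Kᵀ Δ_A`, the restriction of `M` to `ker(Lᵀ Δ_A)` is
injective (`ker M ∩ ker(Lᵀ Δ_A) = {0}`) and symplectic:
`(M z₁)ᵀ Δ_B (M z₂) = z₁ᵀ Δ_A z₂` for all `z₁, z₂ ∈ ker(Lᵀ Δ_A)`. -/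
theorem symplectic_block_matrix_M_restriction
    (nA nB nD nE : ℕ) (hdim : nA + nD = nB + nE)
    (ΔA : Matrix (Fin nA) (Fin nA) ℝ) (ΔB : Matrix (Fin nB) (Fin nB) ℝ)
    (ΔD : Matrix (Fin nD) (Fin nD) ℝ) (ΔE : Matrix (Fin nE) (Fin nE) ℝ)
    (hAinv : IsUnit ΔA) (hBinv : IsUnit ΔB) (hDinv : IsUnit ΔD) (hEinv : IsUnit ΔE)
    (hAalt : ΔAᵀ = -ΔA) (hBalt : ΔBᵀ = -ΔB) (hDalt : ΔDᵀ = -ΔD) (hEalt : ΔEᵀ = -ΔE)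
    (hAsq : ΔA * ΔA = -1) (hBsq : ΔB * ΔB = -1) (hDsq : ΔD * ΔD = -1) (hEsq : ΔE * ΔE = -1)
    (K : Matrix (Fin nA) (Fin nB) ℝ) (L : Matrix (Fin nA) (Fin nE) ℝ)
    (KD : Matrix (Fin nD) (Fin nB) ℝ) (LD : Matrix (Fin nD) (Fin nE) ℝ)
    (hT : (Matrix.fromBlocks K L KD LD)ᵀ * Matrix.fromBlocks ΔA 0 0 ΔD *
        Matrix.fromBlocks K L KD LD = Matrix.fromBlocks ΔB 0 0 ΔE)
    (M : Matrix (Fin nB) (Fin nA) ℝ) (hM : M = ΔB * Kᵀ * ΔA) :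
    LinearMap.ker M.mulVecLin ⊓ LinearMap.ker (Lᵀ * ΔA).mulVecLin = ⊥ ∧
    ∀ z₁ z₂ : Fin nA → ℝ, (Lᵀ * ΔA).mulVec z₁ = 0 → (Lᵀ * ΔA).mulVec z₂ = 0 →
      M.mulVec z₁ ⬝ᵥ ΔB.mulVec (M.mulVec z₂) = z₁ ⬝ᵥ ΔA.mulVec z₂ := by
  have hinv : (-(Matrix.fromBlocks ΔB 0 0 ΔE * (Matrix.fromBlocks K L KD LD)ᵀ *
      Matrix.fromBlocks ΔA 0 0 ΔD)) * Matrix.fromBlocks K L KD LD = 1 := by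
    have h2 : Matrix.fromBlocks ΔB 0 0 ΔE * Matrix.fromBlocks ΔB 0 0 ΔE = -1 := by
      rw [Matrix.fromBlocks_multiply, ← Matrix.fromBlocks_one, Matrix.fromBlocks_neg]
      simp [hBsq, hEsq]
    rw [Matrix.neg_mul, Matrix.mul_assoc, Matrix.mul_assoc, ← Matrix.mul_assoc _ᵀ, hT, h2, neg_neg]
  have hinv2 := (Matrix.mul_eq_one_comm_of_card_eq (Fin nB ⊕ Fin nE) (Fin nA ⊕ Fin nD) ℝ
    (by simp [hdim])).1 hinv
  rw [Matrix.fromBlocks_transpose, Matrix.fromBlocks_multiply, Matrix.fromBlocks_multiply,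
    Matrix.fromBlocks_neg, Matrix.fromBlocks_multiply, ← Matrix.fromBlocks_one,
    Matrix.fromBlocks_inj] at hinv2
  have h11 : K * M + L * (ΔE * (Lᵀ * ΔA)) = -1 := by
    have := hinv2.1
    simp only [Matrix.zero_mul, Matrix.mul_zero, add_zero, zero_add, Matrix.mul_neg] at this
    rw [hM, ← this, ← Matrix.mul_assoc ΔE]
    abel
  have key : ∀ z : Fin nA → ℝ, (Lᵀ * ΔA).mulVec z = 0 → K.mulVec (M.mulVec z) = -z := by
    intro z hz
    have := congrArg (fun N => Matrix.mulVec N z) h11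
    simp only [Matrix.add_mulVec, Matrix.neg_mulVec, Matrix.one_mulVec] at this
    rw [← Matrix.mulVec_mulVec, ← Matrix.mulVec_mulVec z L, ← Matrix.mulVec_mulVec z ΔE, hz] at this
    simpa using this
  refine ⟨?_, ?_⟩
  · rw [eq_bot_iff]
    rintro z ⟨h1, h2⟩
    have h1' : M.mulVec z = 0 := h1
    have := key z h2
    rw [h1', Matrix.mulVec_zero] at this
    simpa using this.symm
  · intro z₁ z₂ h1 _
    have hB : ΔB * M = -(Kᵀ * ΔA) := by
      rw [hM, Matrix.mul_assoc, ← Matrix.mul_assoc ΔB, hBsq, Matrix.neg_mul, Matrix.one_mul]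
    rw [Matrix.mulVec_mulVec, hB, Matrix.neg_mulVec, dotProduct_neg, ← Matrix.mulVec_mulVec,
      Matrix.dotProduct_mulVec, Matrix.vecMul_transpose, key z₁ h1, neg_dotProduct, neg_neg]
end

section
/- Let Φ be a quantum channel in Kraus form from n×n complex matrices to m×m complex matrices, let {ψ_i}_{i∈I} be a finite orthonormal family of vectors in ℂ^n, and let P₀ be the orthogonal projection onto the span H₀ of the ψ_i. Then the following are equivalent: (a) there exist states σ_i (i ∈ I) such that Φ(ρ) = Σ_{i∈I} ⟨ψ_i, ρ ψ_i⟩ σ_i for every n×n matrix ρ with ρ = P₀ ρ P₀; (b) Φ(|ψ_i⟩⟨ψ_j|) = 0 for all i ≠ j. Moreover, when these hold one can take σ_i = Φ(|ψ_i⟩⟨ψ_i|), and for any i, j one has σ_i = σ_j if and only if Φ(|ψ_i⟩⟨ψ_i| − |ψ_j⟩⟨ψ_j|) = 0. -/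
open Matrix
open scoped ComplexOrder

/-- (Lemma 3, Appendix A): for a quantum channel `Φ` in Kraus form and a finite orthonormal
family `{ψ_i}` spanning a subspace `H₀` with orthogonal projection
`P₀ = Σ_i |ψ_i⟩⟨ψ_i|`, the following are equivalent: (a) there exist states `σ_i` such that
`Φ(ρ) = Σ_i ⟨ψ_i, ρ ψ_i⟩ σ_i` for every `ρ` with `ρ = P₀ ρ P₀`;
(b) `Φ(|ψ_i⟩⟨ψ_j|) = 0` for all `i ≠ j`. Moreover, when (b) holds one can take
`σ_i = Φ(|ψ_i⟩⟨ψ_i|)`, and `Φ(|ψ_i⟩⟨ψ_i|) = Φ(|ψ_j⟩⟨ψ_j|)` if and only if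
`Φ(|ψ_i⟩⟨ψ_i| − |ψ_j⟩⟨ψ_j|) = 0`. -/
theorem discrete_cq_subchannel_criterion
    {n m : ℕ} {ι I : Type*} [Fintype ι] [Fintype I] [DecidableEq I]
    (V : ι → Matrix (Fin m) (Fin n) ℂ)
    (hV : ∑ k, (V k)ᴴ * V k = 1)
    (Φ : Matrix (Fin n) (Fin n) ℂ → Matrix (Fin m) (Fin m) ℂ)
    (hΦ : ∀ ρ, Φ ρ = ∑ k, V k * ρ * (V k)ᴴ)
    (ψ : I → (Fin n → ℂ))
    (hortho : ∀ i j, star (ψ i) ⬝ᵥ ψ j = if i = j then 1 else 0)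
    (P₀ : Matrix (Fin n) (Fin n) ℂ)
    (hP₀ : P₀ = ∑ i, vecMulVec (ψ i) (star (ψ i))) :
    ((∃ σ : I → Matrix (Fin m) (Fin m) ℂ,
        (∀ i, (σ i).PosSemidef ∧ (σ i).trace = 1) ∧
        (∀ ρ : Matrix (Fin n) (Fin n) ℂ, P₀ * ρ * P₀ = ρ →
          Φ ρ = ∑ i, (star (ψ i) ⬝ᵥ ρ.mulVec (ψ i)) • σ i))
      ↔ (∀ i j, i ≠ j → Φ (vecMulVec (ψ i) (star (ψ j))) = 0)) ∧
    ((∀ i j, i ≠ j → Φ (vecMulVec (ψ i) (star (ψ j))) = 0) →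
      ∀ ρ : Matrix (Fin n) (Fin n) ℂ, P₀ * ρ * P₀ = ρ →
        Φ ρ = ∑ i, (star (ψ i) ⬝ᵥ ρ.mulVec (ψ i)) •
          Φ (vecMulVec (ψ i) (star (ψ i)))) ∧
    (∀ i j, Φ (vecMulVec (ψ i) (star (ψ i))) = Φ (vecMulVec (ψ j) (star (ψ j))) ↔
      Φ (vecMulVec (ψ i) (star (ψ i)) - vecMulVec (ψ j) (star (ψ j))) = 0) := by
  have hadd : ∀ A B, Φ (A + B) = Φ A + Φ B := by
    intro A B
    simp only [hΦ, Matrix.mul_add, Matrix.add_mul, Finset.sum_add_distrib]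
  have hsmul : ∀ (c : ℂ) A, Φ (c • A) = c • Φ A := by
    intro c A
    simp only [hΦ, Matrix.mul_smul, Matrix.smul_mul, Finset.smul_sum]
  let L : Matrix (Fin n) (Fin n) ℂ →ₗ[ℂ] Matrix (Fin m) (Fin m) ℂ :=
    { toFun := Φ, map_add' := hadd, map_smul' := hsmul }
  have hL : ∀ A, Φ A = L A := fun _ => rfl
  have hexp : ∀ ρ : Matrix (Fin n) (Fin n) ℂ, P₀ * ρ * P₀ =
      ∑ i, ∑ j, (star (ψ i) ⬝ᵥ ρ.mulVec (ψ j)) • vecMulVec (ψ i) (star (ψ j)) := by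
    intro ρ
    rw [hP₀]
    simp only [Finset.sum_mul, Finset.mul_sum]
    rw [Finset.sum_comm]
    refine Finset.sum_congr rfl fun i _ => Finset.sum_congr rfl fun j _ => ?_
    rw [vecMulVec_mul, vecMulVec_mul_vecMulVec, ← dotProduct_mulVec, vecMulVec_smul]
  have hval : ∀ i j k l, star (ψ k) ⬝ᵥ (vecMulVec (ψ i) (star (ψ j))).mulVec (ψ l) =
      if k = i ∧ j = l then 1 else 0 := by
    intro i j k l
    rw [vecMulVec_mulVec, hortho]
    by_cases h1 : k = i <;> by_cases h2 : j = l <;> simp [h1, h2, hortho]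
  have hmain : (∀ i j, i ≠ j → Φ (vecMulVec (ψ i) (star (ψ j))) = 0) →
      ∀ ρ : Matrix (Fin n) (Fin n) ℂ, P₀ * ρ * P₀ = ρ →
        Φ ρ = ∑ i, (star (ψ i) ⬝ᵥ ρ.mulVec (ψ i)) •
          Φ (vecMulVec (ψ i) (star (ψ i))) := by
    intro hb ρ hρ
    have h1 : Φ ρ = Φ (P₀ * ρ * P₀) := by rw [hρ]
    rw [h1, hexp, hL]
    simp only [map_sum, map_smul]
    refine Finset.sum_congr rfl fun i _ => ?_
    rw [Finset.sum_eq_single i]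
    · rfl
    · intro j _ hj
      rw [← hL, hb i j hj.symm, smul_zero]
    · simp
  refine ⟨⟨?_, ?_⟩, hmain, ?_⟩
  · rintro ⟨σ, -, hσ⟩ i j hij
    rw [hσ]
    · refine Finset.sum_eq_zero fun k _ => ?_
      rw [hval, if_neg, zero_smul]
      rintro ⟨rfl, rfl⟩
      exact hij rfl
    · rw [hexp]
      simp only [hval]
      rw [Finset.sum_eq_single i, Finset.sum_eq_single j]
      · simp
      · intro l _ hl
        simp [hl.symm]
      · simp
      · intro k _ hk
        simp [hk]
      · simp
  · intro hb
    refine ⟨fun i => Φ (vecMulVec (ψ i) (star (ψ i))), fun i => ⟨?_, ?_⟩, hmain hb⟩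
    · beta_reduce
      rw [hΦ]
      exact posSemidef_sum _ fun k _ =>
        (posSemidef_vecMulVec_self_star (ψ i)).mul_mul_conjTranspose_same (V k)
    · beta_reduce
      rw [hΦ, trace_sum]
      have : ∀ k, (V k * vecMulVec (ψ i) (star (ψ i)) * (V k)ᴴ).trace =
          ((V k)ᴴ * V k * vecMulVec (ψ i) (star (ψ i))).trace := by
        intro k
        rw [trace_mul_comm, Matrix.mul_assoc]
      simp only [this]
      rw [← trace_sum, ← Finset.sum_mul, hV, Matrix.one_mul, trace_vecMulVec,
        dotProduct_comm, hortho, if_pos rfl]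
  · intro i j
    rw [hL, hL, hL, map_sub, sub_eq_zero]
end

section
/- Let Φ₁ and Φ₂ be quantum channels in Kraus form from n×n complex matrices to m×m complex matrices, let p ∈ (0,1), and let Φ = p·Φ₁ + (1−p)·Φ₂ (which is again a quantum channel in Kraus form, with Kraus operators √p·V_k and √(1−p)·U_k). If Φ is reversible with respect to a family S of states in the n×n matrices, then both Φ₁ and Φ₂ are reversible with respect to S. -/
open Matrix
open scoped ComplexOrder
theorem abs_lemma {E : Type*} [AddCommGroup E] [Module ℝ E] (F : E →ₗ[ℝ] E →ₗ[ℝ] ℝ)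
    (hs : ∀ x y, F x y = F y x) (hp : ∀ x, 0 ≤ F x x) (B : E → E)
    (hB : ∀ x y, F (B x) y = F x (B y)) (x : E) (C : ℝ)
    (hC : ∀ k, F (B^[k] x) (B^[k] x) ≤ C) : F (B x) (B x) ≤ F x x ∧ F (B x) x ≤ F x x := by
  have CS : ∀ x y, F x y ^ 2 ≤ F x x * F y y := by
    intro x y
    have h : ∀ t : ℝ, 0 ≤ F y y * (t * t) + (2 * F x y) * t + F x x := by
      intro t
      have := hp (x + t • y)
      simp only [map_add, map_smul, LinearMap.add_apply, LinearMap.smul_apply, smul_eq_mul, hs y x] at this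
      linarith
    have := discrim_le_zero h
    unfold discrim at this
    linarith
  set d : ℕ → ℝ := fun k => F (B^[k] x) (B^[k] x) with hd
  have hd0 : ∀ k, 0 ≤ d k := fun k => hp _
  have hconv : ∀ k, d (k+1) ^ 2 ≤ d k * d (k+2) := by
    intro k
    have h1 : d (k+1) = F (B^[k] x) (B^[k+2] x) := by
      simp only [hd, Function.iterate_succ_apply']
      rw [hB]
    rw [h1]; exact CS _ _
  have key : d 1 ≤ d 0 := by
    by_contra! hlt
    have h0 : 0 < d 0 := by
      rcases (hd0 0).eq_or_lt with h | h
      · have := hconv 0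
        rw [← h] at this
        have h1 := hd0 1
        rw [← h] at hlt
        simp only [zero_add, zero_mul] at this
        nlinarith
      · exact h
    set r := d 1 / d 0 with hr
    have hr1 : 1 < r := by rw [hr, lt_div_iff₀ h0]; linarith
    have step : ∀ k, 0 < d k ∧ r * d k ≤ d (k+1) := by
      intro k
      induction k with
      | zero => exact ⟨h0, by rw [hr]; field_simp; simp⟩
      | succ k ih =>
        obtain ⟨h1, h2⟩ := ih
        have h3 : 0 < d (k+1) := lt_of_lt_of_le (by positivity) h2
        refine ⟨h3, ?_⟩
        have h4 := hconv k
        have h5 : r * d (k+1) * d k ≤ d (k+2) * d k := by nlinarith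
        exact le_of_mul_le_mul_right h5 h1
    have geo : ∀ k, r ^ k * d 0 ≤ d k := by
      intro k
      induction k with
      | zero => simp
      | succ k ih =>
        have := (step k).2
        calc r ^ (k+1) * d 0 = r * (r ^ k * d 0) := by ring
          _ ≤ r * d k := by gcongr
          _ ≤ _ := this
    obtain ⟨k, hk⟩ := pow_unbounded_of_one_lt (C / d 0) hr1
    rw [div_lt_iff₀ h0] at hk
    have := geo k
    have := hC k
    simp only [hd] at *
    linarith
  have key' : F (B x) (B x) ≤ F x x := by simpa [hd] using key
  refine ⟨key', ?_⟩
  have := CS (B x) x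
  have h0 := hp x
  have h1 : F (B x) x ^ 2 ≤ F x x ^ 2 := by nlinarith
  exact le_trans (le_abs_self _) (abs_le_of_sq_le_sq h1 h0)

theorem sqrt_data {n : Type*} [Fintype n] [DecidableEq n] {σ : Matrix n n ℂ} (h : σ.PosSemidef) :
    ∃ s g : Matrix n n ℂ, s.PosSemidef ∧ g.PosSemidef ∧ s * s = σ ∧ s * g = g * s ∧
      s * g * s = s ∧ g * s * g = g := by
  let U := (h.1.eigenvectorUnitary : Matrix n n ℂ)
  let l := h.1.eigenvalues
  have hU : Uᴴ * U = 1 := by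
    have := Unitary.coe_star_mul_self h.1.eigenvectorUnitary
    simpa [U, star_eq_conjTranspose] using this
  let f : (n → ℝ) → Matrix n n ℂ := fun a => U * diagonal (fun i => (a i : ℂ)) * Uᴴ
  have hf : ∀ a b, f a * f b = f (fun i => a i * b i) := by
    intro a b
    simp only [f]
    calc _ = U * diagonal (fun i => (a i : ℂ)) * (Uᴴ * U) * diagonal (fun i => (b i : ℂ)) * Uᴴ := by
          simp only [Matrix.mul_assoc]
      _ = _ := by rw [hU, Matrix.mul_one, Matrix.mul_assoc U, diagonal_mul_diagonal]; simp
  have hpos : ∀ a : n → ℝ, (∀ i, 0 ≤ a i) → (f a).PosSemidef := by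
    intro a ha
    exact (PosSemidef.diagonal (fun i => by simpa using ha i)).mul_mul_conjTranspose_same U
  have hσ : σ = f l := by
    have := h.1.spectral_theorem
    rw [Unitary.conjStarAlgAut_apply] at this
    exact this
  have hl : ∀ i, 0 ≤ l i := h.eigenvalues_nonneg
  refine ⟨f (fun i => √(l i)), f (fun i => (√(l i))⁻¹), hpos _ (fun i => by positivity),
    hpos _ (fun i => by positivity), ?_, ?_, ?_, ?_⟩
  · rw [hf, hσ]; congr 1; ext i; exact Real.mul_self_sqrt (hl i)
  · rw [hf, hf]; congr 1; ext i; ring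
  · rw [hf, hf]; congr 1; ext i; rcases eq_or_ne (√(l i)) 0 with h0 | h0 <;> simp [h0]
  · rw [hf, hf]; congr 1; ext i; rcases eq_or_ne (√(l i)) 0 with h0 | h0 <;> simp [h0]

theorem tr_pos {n : Type*} [Fintype n] [DecidableEq n] {A B : Matrix n n ℂ} (hA : A.PosSemidef)
    (hB : B.PosSemidef) : 0 ≤ (A * B).trace.re := by
  obtain ⟨s, -, hs, -, rfl, -⟩ := sqrt_data hA
  have : (s * s * B).trace = (s * B * sᴴ).trace := by
    rw [hs.1.eq, Matrix.mul_assoc, Matrix.trace_mul_comm]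
  rw [this]
  exact (Complex.le_def.1 (hB.mul_mul_conjTranspose_same s).trace_nonneg).1

theorem sum_zero {m n ι : Type*} [Fintype m] [Fintype n] [DecidableEq m] (t : Finset ι)
    (A : ι → Matrix m n ℂ) (h : ∑ k ∈ t, A k * (A k)ᴴ = 0) : ∀ k ∈ t, A k = 0 := by
  have h2 : ∑ k ∈ t, (A k * (A k)ᴴ).trace = 0 := by rw [← trace_sum, h, trace_zero]
  rw [Finset.sum_eq_zero_iff_of_nonneg] at h2
  · intro k hk
    exact trace_mul_conjTranspose_self_eq_zero_iff.1 (h2 k hk)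
  · intro k hk
    exact (posSemidef_self_mul_conjTranspose _).trace_nonneg

def kr {m n ι : Type*} [Fintype n] [Fintype ι] (V : ι → Matrix m n ℂ)
    (X : Matrix n n ℂ) : Matrix m m ℂ := ∑ k, V k * X * (V k)ᴴ

section
set_option linter.unusedSectionVars false
variable {m n ι : Type*} [Fintype m] [Fintype n] [Fintype ι] [DecidableEq m] [DecidableEq n]

theorem kr_add (V : ι → Matrix m n ℂ) (X Y : Matrix n n ℂ) : kr V (X + Y) = kr V X + kr V Y := by
  simp [kr, Matrix.mul_add, Matrix.add_mul, Finset.sum_add_distrib]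

theorem kr_sub (V : ι → Matrix m n ℂ) (X Y : Matrix n n ℂ) : kr V (X - Y) = kr V X - kr V Y := by
  simp [kr, Matrix.mul_sub, Matrix.sub_mul, Finset.sum_sub_distrib]

theorem kr_smul (V : ι → Matrix m n ℂ) (c : ℂ) (X : Matrix n n ℂ) :
    kr V (c • X) = c • kr V X := by
  simp [kr, Finset.smul_sum]

theorem kr_conj (V : ι → Matrix m n ℂ) (X : Matrix n n ℂ) : (kr V X)ᴴ = kr V Xᴴ := by
  simp [kr, conjTranspose_sum, Matrix.mul_assoc]

theorem kr_pos (V : ι → Matrix m n ℂ) {X : Matrix n n ℂ} (h : X.PosSemidef) :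
    (kr V X).PosSemidef :=
  posSemidef_sum _ (fun k _ => h.mul_mul_conjTranspose_same (V k))

theorem kr_dual (V : ι → Matrix m n ℂ) (X : Matrix n n ℂ) (Y : Matrix m m ℂ) :
    (kr (fun k => (V k)ᴴ) Y * X).trace = (Y * kr V X).trace := by
  simp only [kr, Matrix.sum_mul, Matrix.mul_sum, trace_sum, conjTranspose_conjTranspose]
  refine Finset.sum_congr rfl fun k _ => ?_
  rw [Matrix.mul_assoc, Matrix.mul_assoc, trace_mul_comm]
  simp only [Matrix.mul_assoc]

theorem herm_bound {x : Matrix n n ℂ} (h : x.IsHermitian) :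
    ∃ c : ℝ, ((c : ℂ) • (1 : Matrix n n ℂ) - x).PosSemidef ∧
      ((c : ℂ) • (1 : Matrix n n ℂ) + x).PosSemidef := by
  let U := (h.eigenvectorUnitary : Matrix n n ℂ)
  let l := h.eigenvalues
  have hU : U * Uᴴ = 1 := by
    have := Unitary.coe_mul_star_self h.eigenvectorUnitary
    simpa [U, star_eq_conjTranspose] using this
  have hx : x = U * diagonal (fun i => (l i : ℂ)) * Uᴴ := by
    have := h.spectral_theorem
    rw [Unitary.conjStarAlgAut_apply] at this
    exact this
  let c : ℝ := ∑ i, |l i|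
  have hc : ∀ i, |l i| ≤ c := fun i =>
    Finset.single_le_sum (f := fun i => |l i|) (fun _ _ => abs_nonneg _) (Finset.mem_univ i)
  have hc1 : (c : ℂ) • (1 : Matrix n n ℂ) = U * diagonal (fun _ => (c : ℂ)) * Uᴴ := by
    rw [← smul_one_eq_diagonal]
    simp [hU]
  refine ⟨c, ?_, ?_⟩
  · rw [hc1, hx, ← Matrix.sub_mul, ← Matrix.mul_sub, diagonal_sub]
    refine (PosSemidef.diagonal (fun i => ?_)).mul_mul_conjTranspose_same U
    have := (abs_le.1 (hc i)).2
    rw [← Complex.ofReal_sub]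
    exact Complex.zero_le_real.2 (by linarith)
  · rw [hc1, hx, ← Matrix.add_mul, ← Matrix.mul_add, diagonal_add]
    refine (PosSemidef.diagonal (fun i => ?_)).mul_mul_conjTranspose_same U
    have := (abs_le.1 (hc i)).1
    rw [← Complex.ofReal_add]
    exact Complex.zero_le_real.2 (by linarith)

/-- the weighted form -/
noncomputable def wF (s : Matrix n n ℂ) : Matrix n n ℂ →ₗ[ℝ] Matrix n n ℂ →ₗ[ℝ] ℝ :=
  LinearMap.mk₂ ℝ (fun x y => (s * xᴴ * s * y).trace.re)
    (by intros; simp [Matrix.mul_add, Matrix.add_mul])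
    (by intros; simp)
    (by intros; simp [Matrix.mul_add])
    (by intros; simp)

theorem wF_apply (s x y : Matrix n n ℂ) : wF s x y = (s * xᴴ * s * y).trace.re := rfl

theorem contraction (V : ι → Matrix m n ℂ) {s : Matrix n n ℂ} {h : Matrix m m ℂ}
    (hs : s.PosSemidef) (hh : h.PosSemidef)
    (hsub : (1 - kr (fun k => (V k)ᴴ) (h * kr V (s * s) * h)).PosSemidef)
    {x : Matrix n n ℂ} (hx : x.IsHermitian) :
    (h * kr V (s * x * s) * h * kr V (s * x * s)).trace.re ≤ (s * x * s * x).trace.re ∧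
    ((s * x * s * x).trace.re ≤ (h * kr V (s * x * s) * h * kr V (s * x * s)).trace.re →
      s * kr (fun k => (V k)ᴴ) (h * kr V (s * x * s) * h) * s = s * x * s) := by
  set B : Matrix n n ℂ → Matrix n n ℂ :=
    fun x => kr (fun k => (V k)ᴴ) (h * kr V (s * x * s) * h) with hBdef
  have hsh : sᴴ = s := hs.1.eq
  have hhh : hᴴ = h := hh.1.eq
  have hBadd : ∀ x y, B (x + y) = B x + B y := fun x y => by
    simp only [hBdef, Matrix.mul_add, Matrix.add_mul, kr_add]
  have hBsub : ∀ x y, B (x - y) = B x - B y := fun x y => by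
    simp only [hBdef, Matrix.mul_sub, Matrix.sub_mul, kr_sub]
  have hBsmul : ∀ (c : ℂ) x, B (c • x) = c • B x := fun c x => by
    simp only [hBdef, Matrix.mul_smul, Matrix.smul_mul, kr_smul]
  have hBconj : ∀ x, (B x)ᴴ = B xᴴ := fun x => by
    simp only [hBdef, kr_conj, conjTranspose_mul, hsh, hhh, Matrix.mul_assoc]
  have conj_pos : ∀ {k : Type _} [Fintype k] {a y : Matrix k k ℂ}, aᴴ = a → y.PosSemidef →
      (a * y * a).PosSemidef := by
    intro k _ a y ha hy
    have := hy.mul_mul_conjTranspose_same a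
    rwa [ha] at this
  have conj_pos' : ∀ {a y : Matrix m m ℂ}, aᴴ = a → y.PosSemidef →
      (a * y * a).PosSemidef := by
    intro a y ha hy
    have := hy.mul_mul_conjTranspose_same a
    rwa [ha] at this
  have hBpos : ∀ {x}, x.PosSemidef → (B x).PosSemidef := fun {x} hx =>
    kr_pos _ (conj_pos' hhh (kr_pos _ (conj_pos hsh hx)))
  have hB1 : (1 - B 1).PosSemidef := by simpa [hBdef] using hsub
  have hFB : ∀ x y, wF s (B x) y = (h * kr V (s * xᴴ * s) * h * kr V (s * y * s)).trace.re := by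
    intro x y
    rw [wF_apply, hBconj, ← kr_dual]
    have : (s * B xᴴ * s * y).trace = (B xᴴ * (s * y * s)).trace := by
      rw [Matrix.mul_assoc, Matrix.mul_assoc, trace_mul_comm]
      simp only [Matrix.mul_assoc]
    rw [this]
  have hsym : ∀ x y, wF s x y = wF s y x := by
    intro x y
    rw [wF_apply, wF_apply, ← Complex.conj_re, ← Complex.star_def, ← trace_conjTranspose]
    simp only [conjTranspose_mul, conjTranspose_conjTranspose, hsh]
    simp only [← Matrix.mul_assoc]
    rw [trace_mul_comm _ s]
    simp only [← Matrix.mul_assoc]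
  have hpos : ∀ x, 0 ≤ wF s x x := by
    intro x
    rw [wF_apply, Matrix.mul_assoc, Matrix.mul_assoc, ← Matrix.mul_assoc xᴴ]
    exact tr_pos hs (hs.conjTranspose_mul_mul_same x)
  have hBsym : ∀ x y, wF s (B x) y = wF s x (B y) := by
    intro x y
    rw [hsym x, hFB, hFB, ← Complex.conj_re, ← Complex.star_def, ← trace_conjTranspose]
    simp only [conjTranspose_mul, conjTranspose_conjTranspose, hsh, hhh, kr_conj]
    simp only [← Matrix.mul_assoc]
    rw [trace_mul_comm _ h]
    simp only [← Matrix.mul_assoc]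
  obtain ⟨c, hc1, hc2⟩ := herm_bound hx
  have hc0 : ∀ (c : ℝ) (y : Matrix n n ℂ), ((c : ℂ) • (1 : Matrix n n ℂ) - y).PosSemidef →
      ((c : ℂ) • (1 : Matrix n n ℂ) + y).PosSemidef → (((c:ℂ)) • (1 - B 1)).PosSemidef := by
    intro c y h1 h2
    have h3 := h1.add h2
    have h4 : ((c : ℂ) • (1 : Matrix n n ℂ)).PosSemidef := by
      have := h3.smul (α := ℝ) (a := 1/2) (by norm_num)
      convert this using 1
      ext i j
      simp
      ring
    rcases isEmpty_or_nonempty n with he | ⟨⟨i⟩⟩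
    · rw [Subsingleton.elim ((c:ℂ) • (1 - B 1)) 0]; exact PosSemidef.zero
    · have := h4.diag_nonneg (i := i)
      simp only [Matrix.smul_apply, one_apply_eq, smul_eq_mul, mul_one] at this
      exact hB1.smul this
  have horb : ∀ k, (B^[k] x).IsHermitian ∧ ((c : ℂ) • (1 : Matrix n n ℂ) - B^[k] x).PosSemidef ∧
      ((c : ℂ) • (1 : Matrix n n ℂ) + B^[k] x).PosSemidef := by
    intro k
    induction k with
    | zero => exact ⟨hx, hc1, hc2⟩
    | succ k ih =>
      obtain ⟨i1, i2, i3⟩ := ih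
      rw [Function.iterate_succ_apply']
      refine ⟨?_, ?_, ?_⟩
      · unfold IsHermitian; rw [hBconj, i1.eq]
      · have := (hc0 c _ i2 i3).add (hBpos i2)
        rw [hBsub, hBsmul, smul_sub, sub_add_sub_cancel] at this
        exact this
      · have := (hc0 c _ i2 i3).add (hBpos i3)
        rw [hBadd, hBsmul, smul_sub, ← add_assoc, sub_add_cancel] at this
        exact this
  have hbd : ∀ k, wF s (B^[k] x) (B^[k] x) ≤ c * c * (s * s).trace.re := by
    intro k
    obtain ⟨i1, i2, i3⟩ := horb k
    set y := B^[k] x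
    have := tr_pos (conj_pos hsh i2) i3
    rw [wF_apply, i1.eq]
    have e : (s * ((c : ℂ) • (1 : Matrix n n ℂ) - y) * s * ((c : ℂ) • (1 : Matrix n n ℂ) + y)).trace
        = (c : ℂ) * c * (s * s).trace - (s * y * s * y).trace := by
      have e2 : (s * y * s).trace = (s * s * y).trace := by
        rw [trace_mul_comm, Matrix.mul_assoc]
      simp only [Matrix.mul_add, Matrix.mul_sub, Matrix.sub_mul, Matrix.mul_smul,
        Matrix.smul_mul, Matrix.mul_one, trace_add, trace_sub, trace_smul, smul_eq_mul, e2]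
      ring
    rw [e, Complex.sub_re, ← Complex.ofReal_mul, Complex.re_ofReal_mul] at this
    linarith
  obtain ⟨r1, r2⟩ := abs_lemma (wF s) hsym hpos B hBsym x _ hbd
  have eB : wF s (B x) x = (h * kr V (s * x * s) * h * kr V (s * x * s)).trace.re := by
    rw [hFB, hx.eq]
  have e1 : wF s x x = (s * x * s * x).trace.re := by rw [wF_apply, hx.eq]
  refine ⟨by rw [← eB, ← e1]; exact r2, fun hle => ?_⟩
  rw [← eB, ← e1] at hle
  have hz : wF s (B x - x) (B x - x) = 0 := by
    refine le_antisymm ?_ (hpos _)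
    simp only [map_sub, LinearMap.sub_apply]
    rw [hsym x (B x)]
    linarith
  obtain ⟨r, -, hr, -, hrr, -⟩ := sqrt_data hs
  set z := B x - x with hzdef
  have hz2 : (r * z * r)ᴴ * (r * z * r) = 0 := by
    rw [← (posSemidef_conjTranspose_mul_self (r * z * r)).trace_eq_zero_iff]
    have e3 : ((r * z * r)ᴴ * (r * z * r)).trace = (s * zᴴ * s * z).trace := by
      simp only [conjTranspose_mul, hr.1.eq, ← hrr]
      simp only [← Matrix.mul_assoc]
      rw [trace_mul_comm _ r]
      simp only [← Matrix.mul_assoc]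
    have h5 := (posSemidef_conjTranspose_mul_self (r * z * r)).trace_nonneg
    rw [wF_apply, ← e3] at hz
    apply Complex.ext
    · exact hz
    · exact (Complex.le_def.1 h5).2.symm
  rw [conjTranspose_mul_self_eq_zero] at hz2
  have : s * z * s = 0 := by
    rw [← hrr]
    calc _ = r * (r * z * r) * r := by simp only [Matrix.mul_assoc]
      _ = 0 := by rw [hz2]; simp
  rw [hzdef, Matrix.mul_sub, Matrix.sub_mul, sub_eq_zero] at this
  exact this

/-- `s` is the square root of `σ`, and `g` the pseudo-inverse of `s`. -/
def SqrtPair (σ s g : Matrix n n ℂ) : Prop :=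
  s.PosSemidef ∧ g.PosSemidef ∧ s * s = σ ∧ s * g = g * s ∧ s * g * s = s ∧ g * s * g = g

theorem SqrtPair.facts {σ s g : Matrix n n ℂ} (h : SqrtPair σ s g) :
    (s * g)ᴴ = s * g ∧ (s * g) * s = s ∧ s * (s * g) = s ∧ (s * g) * (s * g) = s * g ∧
      g * σ * g = s * g ∧ (s * g) * σ = σ ∧ σ * (s * g) = σ := by
  obtain ⟨h1, h2, h3, h4, h5, h6⟩ := h
  have e : s * (s * g) = s := by rw [h4, ← Matrix.mul_assoc, h5]
  refine ⟨by rw [conjTranspose_mul, h1.1.eq, h2.1.eq, h4], h5, e,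
    by rw [← Matrix.mul_assoc, h5], ?_, ?_, ?_⟩
  · rw [← h3, ← Matrix.mul_assoc, ← h4, h5]
  · rw [← h3, ← Matrix.mul_assoc, h5]
  · rw [← h3, Matrix.mul_assoc, e]

theorem supp_lemma (V : ι → Matrix m n ℂ) {s : Matrix n n ℂ} (hs : s.PosSemidef)
    {t h : Matrix m m ℂ} (ht : SqrtPair (kr V (s * s)) t h) (x : Matrix n n ℂ) :
    (t * h) * kr V (s * x * s) * (t * h) = kr V (s * x * s) ∧
      (t * h) * kr V (s * x * s) = kr V (s * x * s) := by
  obtain ⟨f1, f2, f3, f4, f5, f6, f7⟩ := ht.facts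
  have hz : ∑ k, ((1 - t * h) * V k * s) * ((1 - t * h) * V k * s)ᴴ = 0 := by
    have : (1 - t * h) * kr V (s * s) * (1 - t * h)ᴴ = 0 := by
      rw [Matrix.sub_mul, f6]; simp
    rw [← this]
    simp only [kr, Matrix.mul_sum, Matrix.sum_mul, conjTranspose_mul, hs.1.eq, Matrix.mul_assoc]
  have h0 := sum_zero _ _ hz
  have h1 : ∀ k, (t * h) * V k * s = V k * s := by
    intro k
    have := h0 k (Finset.mem_univ k)
    rw [Matrix.sub_mul, Matrix.sub_mul, Matrix.one_mul, sub_eq_zero] at this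
    exact this.symm
  have h2 : ∀ k, s * (V k)ᴴ * (t * h) = s * (V k)ᴴ := by
    intro k
    have := congrArg conjTranspose (h1 k)
    rw [conjTranspose_mul, conjTranspose_mul _ (V k), f1, conjTranspose_mul, hs.1.eq] at this
    rw [Matrix.mul_assoc, this]
  have h3 : (t * h) * kr V (s * x * s) = kr V (s * x * s) := by
    simp only [kr, Matrix.mul_sum]
    refine Finset.sum_congr rfl fun k _ => ?_
    calc _ = ((t * h) * V k * s) * x * s * (V k)ᴴ := by simp only [Matrix.mul_assoc]
      _ = _ := by rw [h1]; simp only [Matrix.mul_assoc]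
  refine ⟨?_, h3⟩
  rw [h3]
  simp only [kr, Matrix.sum_mul]
  refine Finset.sum_congr rfl fun k _ => ?_
  calc _ = V k * s * x * (s * (V k)ᴴ * (t * h)) := by simp only [Matrix.mul_assoc]
    _ = _ := by rw [h2]; simp only [Matrix.mul_assoc]

theorem sub_lemma (V : ι → Matrix m n ℂ) (hV : ∑ k, (V k)ᴴ * V k = 1)
    {τ t h : Matrix m m ℂ} (ht : SqrtPair τ t h) :
    (1 - kr (fun k => (V k)ᴴ) (h * τ * h)).PosSemidef := by
  obtain ⟨f1, f2, f3, f4, f5, f6, f7⟩ := ht.facts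
  rw [f5]
  have e : 1 - kr (fun k => (V k)ᴴ) (t * h) = kr (fun k => (V k)ᴴ) (1 - t * h) := by
    rw [kr_sub]; simp [kr, hV]
  rw [e]
  apply kr_pos
  have : (1 - t * h) = (1 - t * h)ᴴ * (1 - t * h) := by
    rw [conjTranspose_sub, f1, conjTranspose_one, Matrix.sub_mul, Matrix.mul_sub, Matrix.mul_sub, f4]
    simp
  rw [this]
  exact posSemidef_conjTranspose_mul_self _

theorem recover {κ : Type*} [Fintype κ] (V : ι → Matrix m n ℂ) (hV : ∑ k, (V k)ᴴ * V k = 1)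
    (W : κ → Matrix n m ℂ) (hW : ∑ k, (W k)ᴴ * W k = 1)
    {s : Matrix n n ℂ} (hs : s.PosSemidef)
    {t h : Matrix m m ℂ} (ht : SqrtPair (kr V (s * s)) t h) (S : Set (Matrix n n ℂ))
    (hS : ∀ ρ ∈ S, ∃ x : Matrix n n ℂ, x.IsHermitian ∧ s * x * s = ρ ∧
      (s * x * s * x).trace.re ≤ (h * kr V (s * x * s) * h * kr V (s * x * s)).trace.re) :
    ∃ (N : ℕ) (R : Fin N → Matrix n m ℂ), (∑ k, (R k)ᴴ * R k = 1) ∧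
      ∀ ρ ∈ S, ∑ k, R k * kr V ρ * (R k)ᴴ = ρ := by
  obtain ⟨f1, f2, f3, f4, f5, f6, f7⟩ := ht.facts
  have hh : hᴴ = h := ht.2.1.1.eq
  let R : ι ⊕ κ → Matrix n m ℂ := Sum.elim (fun k => s * (V k)ᴴ * h) (fun k => W k * (1 - t * h))
  let e := Fintype.equivFin (ι ⊕ κ)
  refine ⟨Fintype.card (ι ⊕ κ), fun k => R (e.symm k), ?_, ?_⟩
  · rw [Equiv.sum_comp e.symm (fun k => (R k)ᴴ * R k), Fintype.sum_sum_type]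
    simp only [R, Sum.elim_inl, Sum.elim_inr]
    have e1 : ∑ k, (s * (V k)ᴴ * h)ᴴ * (s * (V k)ᴴ * h) = t * h := by
      rw [← f5]
      simp only [kr, Matrix.mul_sum, Matrix.sum_mul, conjTranspose_mul, hs.1.eq, hh,
        conjTranspose_conjTranspose, Matrix.mul_assoc]
    have e2 : ∑ k, (W k * (1 - t * h))ᴴ * (W k * (1 - t * h)) = 1 - t * h := by
      have : (1 - t * h)ᴴ * (∑ k, (W k)ᴴ * W k) * (1 - t * h) = 1 - t * h := by
        rw [hW, conjTranspose_sub, f1, conjTranspose_one, Matrix.mul_one, Matrix.sub_mul,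
          Matrix.mul_sub, Matrix.mul_sub, f4]
        simp
      refine Eq.trans ?_ this
      rw [Matrix.mul_sum, Matrix.sum_mul]
      refine Finset.sum_congr rfl fun k _ => ?_
      rw [conjTranspose_mul (W k)]
      simp only [Matrix.mul_assoc]
    rw [e1, e2]; simp
  · intro ρ hρ
    obtain ⟨x, hx, hsx, hle⟩ := hS ρ hρ
    rw [Equiv.sum_comp e.symm (fun k => R k * kr V ρ * (R k)ᴴ), Fintype.sum_sum_type]
    simp only [R, Sum.elim_inl, Sum.elim_inr]
    have e2 : ∀ k, W k * (1 - t * h) * kr V ρ * (W k * (1 - t * h))ᴴ = 0 := by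
      intro k
      have : (1 - t * h) * kr V ρ = 0 := by
        rw [← hsx, Matrix.sub_mul, (supp_lemma V hs ht x).2]; simp
      rw [Matrix.mul_assoc (W k), this]; simp
    have e1 := (contraction V hs ht.2.1 (sub_lemma V hV ht) hx).2 hle
    rw [hsx] at e1
    simp only [e2, Finset.sum_const_zero, add_zero]
    refine Eq.trans ?_ e1
    simp only [kr, Matrix.mul_sum, Matrix.sum_mul, conjTranspose_mul, hs.1.eq, hh,
        conjTranspose_conjTranspose, Matrix.mul_assoc]

theorem exists_sigma (S : Set (Matrix n n ℂ)) (hS : ∀ ρ ∈ S, ρ.PosSemidef) :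
    ∃ T : Finset (Matrix n n ℂ), ↑T ⊆ S ∧ ∃ s g : Matrix n n ℂ, SqrtPair (∑ ρ ∈ T, ρ) s g ∧
      ∀ ρ ∈ S, s * (g * ρ * g) * s = ρ := by
  obtain ⟨T, hT, hspan⟩ := (Submodule.fg_span_iff_fg_span_finset_subset S).1
    (IsNoetherian.noetherian (Submodule.span ℂ S))
  obtain ⟨s, g, hsg⟩ := sqrt_data (σ := ∑ ρ ∈ T, ρ) (posSemidef_sum T (fun ρ h => hS ρ (hT h)))
  refine ⟨T, hT, s, g, hsg, ?_⟩
  have hsg' : SqrtPair (∑ ρ ∈ T, ρ) s g := hsg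
  obtain ⟨f1, f2, f3, f4, f5, f6, f7⟩ := hsg'.facts
  have hcomm : s * g = g * s := hsg.2.2.2.1
  have hP : ∀ ρ ∈ T, (s * g) * ρ = ρ := by
    have hr : ∀ ρ : Matrix n n ℂ, ∃ r : Matrix n n ℂ, ρ ∈ T → ρ = r * rᴴ := by
      intro ρ
      by_cases h : ρ ∈ T
      · obtain ⟨r, -, hr, -, hrr, -⟩ := sqrt_data (hS ρ (hT h))
        exact ⟨r, fun _ => by rw [hr.1.eq, hrr]⟩
      · exact ⟨0, fun h' => absurd h' h⟩
    choose r hr using hr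
    have hz : ∑ ρ ∈ T, ((1 - s * g) * r ρ) * ((1 - s * g) * r ρ)ᴴ = 0 := by
      have : (1 - s * g) * (∑ ρ ∈ T, ρ) * (1 - s * g)ᴴ = 0 := by
        rw [Matrix.sub_mul, f6]; simp
      rw [← this, Matrix.mul_sum, Matrix.sum_mul]
      refine Finset.sum_congr rfl fun ρ hρ => ?_
      conv_rhs => rw [hr ρ hρ]
      simp only [conjTranspose_mul, Matrix.mul_assoc]
    have h0 := sum_zero _ _ hz
    intro ρ hρ
    have := h0 ρ hρ
    rw [Matrix.sub_mul, Matrix.one_mul, sub_eq_zero] at this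
    have h2 := hr ρ hρ
    calc (s * g) * ρ = (s * g) * (r ρ * (r ρ)ᴴ) := by rw [← h2]
      _ = ρ := by rw [← Matrix.mul_assoc, ← this, ← h2]
  have hP2 : ∀ ρ ∈ S, (s * g) * ρ = ρ := by
    intro ρ hρ
    have : ρ ∈ Submodule.span ℂ (T : Set (Matrix n n ℂ)) := hspan ▸ Submodule.subset_span hρ
    clear hρ
    induction this using Submodule.span_induction with
    | mem x hx => exact hP x hx
    | zero => simp
    | add x y _ _ hx hy => rw [Matrix.mul_add, hx, hy]
    | smul c x _ hx => rw [Matrix.mul_smul, hx]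
  intro ρ hρ
  have h1 := hP2 ρ hρ
  have h2 : ρ * (s * g) = ρ := by
    have := congrArg conjTranspose h1
    rwa [conjTranspose_mul, f1, (hS ρ hρ).1.eq] at this
  calc _ = (s * g) * ρ * (g * s) := by simp only [Matrix.mul_assoc]
    _ = ρ := by rw [h1, ← hcomm, h2]

theorem block_pos {A D : Matrix m m ℂ} (hA : A.PosSemidef) (hD : D.PosSemidef) :
    (fromBlocks A 0 0 D).PosSemidef := by
  obtain ⟨a, -, ha, -, haa, -⟩ := sqrt_data hA
  obtain ⟨d, -, hd, -, hdd, -⟩ := sqrt_data hD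
  have : fromBlocks A 0 0 D = (fromBlocks a 0 0 d)ᴴ * fromBlocks a 0 0 d := by
    simp [fromBlocks_conjTranspose, fromBlocks_multiply, ha.1.eq, hd.1.eq, haa, hdd]
  rw [this]
  exact posSemidef_conjTranspose_mul_self _

theorem trace_blocks (A B C D : Matrix m m ℂ) :
    (fromBlocks A B C D).trace = A.trace + D.trace := by
  simp [Matrix.trace, Fintype.sum_sum_type]

theorem mix_lemma {κ : Type*} [Fintype κ] (W : κ → Matrix n m ℂ) (hW : ∑ k, (W k)ᴴ * W k = 1)
    {t₁ t₂ y₁ y₂ : Matrix m m ℂ} (ht₁ : t₁.PosSemidef) (ht₂ : t₂.PosSemidef)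
    (hy₁ : y₁.IsHermitian) (hy₂ : y₂.IsHermitian) {p q : ℝ} (hp : 0 ≤ p) (hq : 0 ≤ q)
    {σ s g ρ : Matrix n n ℂ} (hs : SqrtPair σ s g)
    (hσ : kr W ((p : ℂ) • (t₁ * t₁) + (q : ℂ) • (t₂ * t₂)) = σ)
    (hρ : kr W ((p : ℂ) • (t₁ * y₁ * t₁) + (q : ℂ) • (t₂ * y₂ * t₂)) = ρ) :
    (g * ρ * g * ρ).trace.re ≤
      p * (t₁ * y₁ * t₁ * y₁).trace.re + q * (t₂ * y₂ * t₂ * y₂).trace.re := by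
  let W' : κ ⊕ κ → Matrix n (m ⊕ m) ℂ :=
    Sum.elim (fun k => fromCols (W k) 0) (fun k => fromCols 0 (W k))
  have hkr : ∀ A D : Matrix m m ℂ, kr W' (fromBlocks A 0 0 D) = kr W (A + D) := by
    intro A D
    rw [kr_add]
    simp only [kr, W', Fintype.sum_sum_type, Sum.elim_inl, Sum.elim_inr,
      conjTranspose_fromCols_eq_fromRows_conjTranspose, fromCols_mul_fromBlocks,
      fromCols_mul_fromRows]
    simp
  have hW' : ∑ k, (W' k)ᴴ * W' k = 1 := by
    simp only [W', Fintype.sum_sum_type, Sum.elim_inl, Sum.elim_inr,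
      conjTranspose_fromCols_eq_fromRows_conjTranspose, fromRows_mul_fromCols]
    simp only [conjTranspose_zero, Matrix.zero_mul, Matrix.mul_zero]
    rw [← fromBlocks_one, ← hW]
    ext i j
    rcases i with i | i <;> rcases j with j | j <;> simp [Matrix.sum_apply]
  let a : ℂ := (√p : ℝ)
  let b : ℂ := (√q : ℝ)
  have haa : a * a = p := by simp only [a]; rw [← Complex.ofReal_mul, Real.mul_self_sqrt hp]
  have hbb : b * b = q := by simp only [b]; rw [← Complex.ofReal_mul, Real.mul_self_sqrt hq]
  have ha0 : 0 ≤ a := Complex.zero_le_real.2 (Real.sqrt_nonneg _)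
  have hb0 : 0 ≤ b := Complex.zero_le_real.2 (Real.sqrt_nonneg _)
  let T := fromBlocks (a • t₁) 0 0 (b • t₂)
  let Y := fromBlocks y₁ 0 0 y₂
  have hT : T.PosSemidef := block_pos (ht₁.smul ha0) (ht₂.smul hb0)
  have hY : Y.IsHermitian := by
    unfold IsHermitian
    simp [Y, fromBlocks_conjTranspose, hy₁.eq, hy₂.eq]
  have hTT : T * T = fromBlocks ((p : ℂ) • (t₁ * t₁)) 0 0 ((q : ℂ) • (t₂ * t₂)) := by
    simp [T, fromBlocks_multiply, smul_smul, haa, hbb]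
  have hTYT : T * Y * T =
      fromBlocks ((p : ℂ) • (t₁ * y₁ * t₁)) 0 0 ((q : ℂ) • (t₂ * y₂ * t₂)) := by
    simp [T, Y, fromBlocks_multiply, smul_smul, haa, hbb]
  have hk1 : kr W' (T * T) = σ := by rw [hTT, hkr, hσ]
  have hk2 : kr W' (T * Y * T) = ρ := by rw [hTYT, hkr, hρ]
  have key := (contraction W' hT hs.2.1 (by rw [hk1]; exact sub_lemma W' hW' hs) hY).1
  rw [hk2] at key
  refine key.trans (le_of_eq ?_)
  rw [hTYT]
  simp [Y, fromBlocks_multiply, trace_blocks]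

end

/-- (Proposition 1, the "face property"): if a convex mixture
`Φ = p·Φ₁ + (1−p)·Φ₂` of two quantum channels in Kraus form is reversible with respect to a
family `S` of states, then both `Φ₁` and `Φ₂` are reversible with respect to `S`. -/
theorem face_property_of_reversibility
    {n m : ℕ} {ι₁ ι₂ : Type*} [Fintype ι₁] [Fintype ι₂]
    (V : ι₁ → Matrix (Fin m) (Fin n) ℂ) (hV : ∑ k, (V k)ᴴ * V k = 1)
    (U : ι₂ → Matrix (Fin m) (Fin n) ℂ) (hU : ∑ k, (U k)ᴴ * U k = 1)
    (Φ₁ Φ₂ Φ : Matrix (Fin n) (Fin n) ℂ → Matrix (Fin m) (Fin m) ℂ)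
    (hΦ₁ : ∀ ρ, Φ₁ ρ = ∑ k, V k * ρ * (V k)ᴴ)
    (hΦ₂ : ∀ ρ, Φ₂ ρ = ∑ k, U k * ρ * (U k)ᴴ)
    (p : ℝ) (hp : 0 < p) (hp1 : p < 1)
    (hΦ : ∀ ρ, Φ ρ = (p : ℂ) • Φ₁ ρ + ((1 - p : ℝ) : ℂ) • Φ₂ ρ)
    (S : Set (Matrix (Fin n) (Fin n) ℂ))
    (hS : ∀ ρ ∈ S, ρ.PosSemidef ∧ ρ.trace = 1)
    (hrev : ∃ (κ : ℕ) (W : Fin κ → Matrix (Fin n) (Fin m) ℂ),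
      (∑ k, (W k)ᴴ * W k = 1) ∧ ∀ ρ ∈ S, ∑ k, W k * Φ ρ * (W k)ᴴ = ρ) :
    (∃ (κ : ℕ) (W : Fin κ → Matrix (Fin n) (Fin m) ℂ),
      (∑ k, (W k)ᴴ * W k = 1) ∧ ∀ ρ ∈ S, ∑ k, W k * Φ₁ ρ * (W k)ᴴ = ρ) ∧
    (∃ (κ : ℕ) (W : Fin κ → Matrix (Fin n) (Fin m) ℂ),
      (∑ k, (W k)ᴴ * W k = 1) ∧ ∀ ρ ∈ S, ∑ k, W k * Φ₂ ρ * (W k)ᴴ = ρ) := by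
  obtain ⟨κ, W, hW, hrec⟩ := hrev
  obtain ⟨T, hT, s, g, hsg, hsupp⟩ := exists_sigma S (fun ρ h => (hS ρ h).1)
  have hs := hsg.1
  have hg := hsg.2.1
  have hss : s * s = ∑ ρ ∈ T, ρ := hsg.2.2.1
  have hrec' : ∀ ρ ∈ S, kr W ((p : ℂ) • kr V ρ + ((1 - p : ℝ) : ℂ) • kr U ρ) = ρ := by
    intro ρ hρ
    have := hrec ρ hρ
    rw [hΦ, hΦ₁, hΦ₂] at this
    exact this
  have hσ : kr W ((p : ℂ) • kr V (s * s) + ((1 - p : ℝ) : ℂ) • kr U (s * s)) = s * s := by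
    rw [hss]
    refine Finset.sum_induction (fun ρ => ρ)
      (fun X => kr W ((p : ℂ) • kr V X + ((1 - p : ℝ) : ℂ) • kr U X) = X) ?_ ?_ ?_
    · intro A B hA hB
      rw [kr_add V, kr_add U, smul_add, smul_add, add_add_add_comm, kr_add, hA, hB]
    · simp [kr]
    · intro ρ hρ
      exact hrec' ρ (hT hρ)
  obtain ⟨t₁, h₁, hth₁⟩ := sqrt_data (kr_pos V (show (s * s).PosSemidef by
    rw [hss]; exact posSemidef_sum T (fun ρ h => (hS ρ (hT h)).1)))
  obtain ⟨t₂, h₂, hth₂⟩ := sqrt_data (kr_pos U (show (s * s).PosSemidef by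
    rw [hss]; exact posSemidef_sum T (fun ρ h => (hS ρ (hT h)).1)))
  have sp₁ : SqrtPair (kr V (s * s)) t₁ h₁ := hth₁
  have sp₂ : SqrtPair (kr U (s * s)) t₂ h₂ := hth₂
  have hherm : ∀ ρ ∈ S, (g * ρ * g).IsHermitian := by
    intro ρ hρ
    have := isHermitian_mul_mul_conjTranspose g (hS ρ hρ).1.1
    rwa [hg.1.eq] at this
  -- the key equality of the weighted norms
  have hkey : ∀ ρ ∈ S,
      (s * (g * ρ * g) * s * (g * ρ * g)).trace.re ≤
        (h₁ * kr V (s * (g * ρ * g) * s) * h₁ * kr V (s * (g * ρ * g) * s)).trace.re ∧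
      (s * (g * ρ * g) * s * (g * ρ * g)).trace.re ≤
        (h₂ * kr U (s * (g * ρ * g) * s) * h₂ * kr U (s * (g * ρ * g) * s)).trace.re := by
    intro ρ hρ
    have c1 := (contraction V hs sp₁.2.1 (sub_lemma V hV sp₁) (hherm ρ hρ)).1
    have c2 := (contraction U hs sp₂.2.1 (sub_lemma U hU sp₂) (hherm ρ hρ)).1
    have u1 := (supp_lemma V hs sp₁ (g * ρ * g)).1
    have u2 := (supp_lemma U hs sp₂ (g * ρ * g)).1
    rw [hsupp ρ hρ] at c1 c2 u1 u2 ⊢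
    have v : ∀ {τ t h Y : Matrix (Fin m) (Fin m) ℂ}, SqrtPair τ t h → t * h * Y * (t * h) = Y →
        t * (h * Y * h) * t = Y := by
      intro τ t h Y hp hY
      have := hp.2.2.2.1
      calc _ = t * h * Y * (h * t) := by simp only [Matrix.mul_assoc]
        _ = Y := by rw [← this, hY]
    have v1 := v sp₁ u1
    have v2 := v sp₂ u2
    have hh : ∀ {h Y : Matrix (Fin m) (Fin m) ℂ}, h.IsHermitian → Y.IsHermitian →
        (h * Y * h).IsHermitian := by
      intro h Y a b
      have := isHermitian_mul_mul_conjTranspose h b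
      rwa [a.eq] at this
    have mx := mix_lemma W hW sp₁.1 sp₂.1
      (hh sp₁.2.1.1 (kr_pos V (hS ρ hρ).1).1) (hh sp₂.2.1.1 (kr_pos U (hS ρ hρ).1).1)
      hp.le (sub_nonneg.2 hp1.le) (ρ := ρ) hsg (by rw [sp₁.2.2.1, sp₂.2.2.1, hσ, hss])
      (by rw [v1, v2, hrec' ρ hρ])
    rw [v1, v2, trace_mul_comm (kr V ρ), trace_mul_comm (kr U ρ)] at mx
    rw [trace_mul_comm ρ] at c1 c2 ⊢
    constructor <;> nlinarith
  constructor
  · obtain ⟨N, R, h1, h2⟩ := recover V hV W hW hs sp₁ S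
      (fun ρ hρ => ⟨g * ρ * g, hherm ρ hρ, hsupp ρ hρ, (hkey ρ hρ).1⟩)
    refine ⟨N, R, h1, fun ρ hρ => ?_⟩
    rw [hΦ₁]
    exact h2 ρ hρ
  · obtain ⟨N, R, h1, h2⟩ := recover U hU W hW hs sp₂ S
      (fun ρ hρ => ⟨g * ρ * g, hherm ρ hρ, hsupp ρ hρ, (hkey ρ hρ).2⟩)
    refine ⟨N, R, h1, fun ρ hρ => ?_⟩
    rw [hΦ₂]
    exact h2 ρ hρ
end
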